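/- Let n ≥ 2, 0 < α ≤ (n−1)/2 and s > (n−α)/2. Then there is a constant C > 0 such that for every finite Borel measure μ on ℝⁿ supported in B(0,1) with [μ]_α < ∞ and every Schwartz function f on ℝⁿ one has ∫_{ℝⁿ} sup_{0 < t < 1} |e^{it√(−Δ)}f(x)|² dμ(x) ≤ C [μ]_α ‖f‖²_{H^s}. -/

import Mathlib

open MeasureTheory Real Metric
open scoped ENNReal RealInnerProductSpace

noncomputable section

abbrev E (n : ℕ) : Type := EuclideanSpace ℝ (Fin n)

/-- The Frostman constant `[μ]_α = sup_{x,r>0} μ(B(x,r))/r^α`. -/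
def frostman {d : ℕ} (μ : Measure (E d)) (α : ℝ) : ℝ≥0∞ :=
  ⨆ (x : E d) (r : ℝ) (_ : 0 < r), μ (Metric.ball x r) / ENNReal.ofReal (r ^ α)

/-- The Fourier transform `f̂(ξ) = ∫ e^{-2πi x·ξ} f(x) dx`. -/
def FT {n : ℕ} (f : E n → ℂ) (ξ : E n) : ℂ :=
  ∫ x, Complex.exp (((-2 * π * ⟪x, ξ⟫ : ℝ) : ℂ) * Complex.I) * f x

/-- The Sobolev norm `‖f‖_{H^s} = (∫ (1+|ξ|²)^s |f̂(ξ)|² dξ)^{1/2}`. -/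
def sobolevNorm {n : ℕ} (f : E n → ℂ) (s : ℝ) : ℝ :=
  (∫ ξ : E n, (1 + ‖ξ‖ ^ 2) ^ s * ‖FT f ξ‖ ^ 2) ^ (1/2 : ℝ)

/-- The half-wave propagator `e^{it√(-Δ)}f(x) = ∫ e^{2πi(x·ξ+t|ξ|)} f̂(ξ) dξ`. -/
def halfWave {n : ℕ} (f : E n → ℂ) (t : ℝ) (x : E n) : ℂ :=
  ∫ ξ : E n, Complex.exp (((2 * π * (⟪x, ξ⟫ + t * ‖ξ‖) : ℝ) : ℂ) * Complex.I) * FT f ξ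

open Set

/-- The unimodular exponential `e^{2πit}`. -/
def unitExp (t : ℝ) : ℂ := Complex.exp (((2 * π * t : ℝ) : ℂ) * Complex.I)

lemma norm_unitExp (t : ℝ) : ‖unitExp t‖ = 1 := Complex.norm_exp_ofReal_mul_I _

lemma unitExp_add (s t : ℝ) : unitExp (s + t) = unitExp s * unitExp t := by
  rw [unitExp, unitExp, unitExp, ← Complex.exp_add]; push_cast; ring_nf

lemma star_unitExp (t : ℝ) : (starRingEnd ℂ) (unitExp t) = unitExp (-t) := by
  rw [unitExp, unitExp, ← Complex.exp_conj, map_mul, Complex.conj_ofReal, Complex.conj_I]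
  push_cast; ring_nf

lemma continuous_unitExp : Continuous unitExp := by unfold unitExp; fun_prop

@[fun_prop]
lemma measurable_unitExp : Measurable unitExp := continuous_unitExp.measurable

section TTStar

variable {X Y : Type*} [MeasurableSpace X] [MeasurableSpace Y]

lemma integrable_of_measurable_bounded {μ : Measure X} [IsFiniteMeasure μ] {F : X → ℂ}
    (hF : Measurable F) {B : ℝ} (hB : ∀ x, ‖F x‖ ≤ B) : Integrable F μ :=
  Integrable.of_bound hF.aestronglyMeasurable B (Filter.Eventually.of_forall hB)

lemma integrable_real_of_measurable_bounded {μ : Measure X} [IsFiniteMeasure μ] {F : X → ℝ}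
    (hF : Measurable F) {B : ℝ} (hB : ∀ x, |F x| ≤ B) : Integrable F μ :=
  Integrable.of_bound hF.aestronglyMeasurable B (Filter.Eventually.of_forall hB)

lemma norm_integral_le_measure_mul {μ : Measure X} [IsFiniteMeasure μ] {F : X → ℂ}
    {B : ℝ} (hB : ∀ x, ‖F x‖ ≤ B) : ‖∫ x, F x ∂μ‖ ≤ B * μ.real univ :=
  norm_integral_le_of_norm_le_const (Filter.Eventually.of_forall hB)

lemma measurable_integral_right {σ : Measure Y} [SFinite σ] {F : X × Y → ℂ}
    (hF : Measurable F) : Measurable fun x => ∫ y, F (x, y) ∂σ :=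
  (hF.stronglyMeasurable.integral_prod_right').measurable

/-- Schur's test for a bounded kernel of the form `∫ e(φ(x,ω) - φ(x',ω)) dσ(ω)`. -/
lemma schur_quadratic_form {μ : Measure X} [IsFiniteMeasure μ] {F : X → ℂ} (hF : Measurable F)
    {B : ℝ} (hB : ∀ x, ‖F x‖ ≤ B) {K : X × X → ℂ} (hK : Measurable K) {D : ℝ}
    (hD : ∀ p, ‖K p‖ ≤ D) (hsymm : ∀ p, ‖K p.swap‖ = ‖K p‖) {A : ℝ}
    (hA : ∀ᵐ x ∂μ, ∫ x', ‖K (x, x')‖ ∂μ ≤ A) :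
    ‖∫ p, F p.1 * (starRingEnd ℂ) (F p.2) * K p ∂(μ.prod μ)‖ ≤ A * ∫ x, ‖F x‖ ^ 2 ∂μ := by
  have hF1 : Integrable (fun p : X × X => ‖F p.1‖ ^ 2 * ‖K p‖) (μ.prod μ) := by
    refine integrable_real_of_measurable_bounded (B := B ^ 2 * D) (by fun_prop) fun p => ?_
    rw [abs_of_nonneg (by positivity)]
    have := hB p.1; have := hD p
    gcongr
  have hF2 : Integrable (fun p : X × X => ‖F p.2‖ ^ 2 * ‖K p‖) (μ.prod μ) := by
    refine integrable_real_of_measurable_bounded (B := B ^ 2 * D) (by fun_prop) fun p => ?_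
    rw [abs_of_nonneg (by positivity)]
    have := hB p.2; have := hD p
    gcongr
  have h1 : ∫ p, ‖F p.1‖ ^ 2 * ‖K p‖ ∂(μ.prod μ) ≤ A * ∫ x, ‖F x‖ ^ 2 ∂μ := by
    rw [integral_prod _ hF1, ← integral_const_mul]
    refine integral_mono_ae hF1.integral_prod_left ?_ ?_
    · refine integrable_real_of_measurable_bounded (B := |A| * B ^ 2) (by fun_prop) fun x => ?_
      rw [abs_mul, abs_of_nonneg (sq_nonneg ‖F x‖)]
      have := hB x
      gcongr
    · filter_upwards [hA] with x hx
      rw [integral_const_mul, mul_comm]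
      gcongr
  have h2 : ∫ p, ‖F p.2‖ ^ 2 * ‖K p‖ ∂(μ.prod μ) = ∫ p, ‖F p.1‖ ^ 2 * ‖K p‖ ∂(μ.prod μ) := by
    rw [← integral_prod_swap]
    simp [hsymm]
  calc ‖∫ p, F p.1 * (starRingEnd ℂ) (F p.2) * K p ∂(μ.prod μ)‖
      ≤ ∫ p, (1 / 2 * (‖F p.1‖ ^ 2 * ‖K p‖) + 1 / 2 * (‖F p.2‖ ^ 2 * ‖K p‖)) ∂(μ.prod μ) := by
        refine norm_integral_le_of_norm_le ((hF1.const_mul _).add (hF2.const_mul _)) ?_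
        refine Filter.Eventually.of_forall fun p => ?_
        simp only [norm_mul, RCLike.norm_conj]
        nlinarith [mul_nonneg (sq_nonneg (‖F p.1‖ - ‖F p.2‖)) (norm_nonneg (K p))]
    _ ≤ A * ∫ x, ‖F x‖ ^ 2 ∂μ := by
        rw [integral_add (hF1.const_mul _) (hF2.const_mul _), integral_const_mul,
          integral_const_mul, h2]
        linarith

/-- The `TT*` estimate for an oscillatory integral operator, with Schur's test applied to `TT*`. -/
theorem oscillatory_TTStar {μ : Measure X} [IsFiniteMeasure μ] {σ : Measure Y} [IsFiniteMeasure σ]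
    {φ : X × Y → ℝ} (hφ : Measurable φ) {g : Y → ℂ} (hg : Measurable g) {B : ℝ}
    (hB : ∀ ω, ‖g ω‖ ≤ B) {A : ℝ} (hA0 : 0 < A)
    (hA : ∀ᵐ x ∂μ, ∫ x', ‖∫ ω, unitExp (φ (x', ω) - φ (x, ω)) ∂σ‖ ∂μ ≤ A) :
    ∫ x, ‖∫ ω, unitExp (φ (x, ω)) * g ω ∂σ‖ ^ 2 ∂μ ≤ A * ∫ ω, ‖g ω‖ ^ 2 ∂σ := by
  set F : X → ℂ := fun x => ∫ ω, unitExp (φ (x, ω)) * g ω ∂σ with hFdef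
  have hF : Measurable F :=
    measurable_integral_right (F := fun p : X × Y => unitExp (φ p) * g p.2) (by fun_prop)
  set B' := B * σ.real univ
  have hB' : ∀ x, ‖F x‖ ≤ B' := fun x =>
    norm_integral_le_measure_mul fun ω => by rw [norm_mul, norm_unitExp, one_mul]; exact hB ω
  set H : Y → ℂ := fun ω => ∫ x, F x * unitExp (-φ (x, ω)) ∂μ with hHdef
  have hH : Measurable H :=
    measurable_integral_right (F := fun p : Y × X => F p.2 * unitExp (-φ p.swap)) (by fun_prop)
  have hHB : ∀ ω, ‖H ω‖ ≤ B' * μ.real univ := fun x =>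
    norm_integral_le_measure_mul fun ω => by rw [norm_mul, norm_unitExp, mul_one]; exact hB' ω
  set K : X × X → ℂ := fun p => ∫ ω, unitExp (φ (p.2, ω) - φ (p.1, ω)) ∂σ with hKdef
  have hK : Measurable K :=
    measurable_integral_right
      (F := fun p : (X × X) × Y => unitExp (φ (p.1.2, p.2) - φ (p.1.1, p.2))) (by fun_prop)
  have hKD : ∀ p, ‖K p‖ ≤ 1 * σ.real univ := fun p =>
    norm_integral_le_measure_mul fun ω => (norm_unitExp _).le
  have hKs : ∀ p, ‖K p.swap‖ = ‖K p‖ := fun p => by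
    rw [← RCLike.norm_conj (K p), hKdef]
    simp only [← integral_conj, star_unitExp, Prod.fst_swap, Prod.snd_swap, neg_sub]
  -- duality
  have hB0 : ∀ (x : X) , 0 ≤ B' := fun x => (norm_nonneg _).trans (hB' x)
  have e1 : ((∫ x, ‖F x‖ ^ 2 ∂μ : ℝ) : ℂ) = ∫ ω, g ω * (starRingEnd ℂ) (H ω) ∂σ := by
    have : ∀ x, ((‖F x‖ ^ 2 : ℝ) : ℂ)
        = ∫ ω, unitExp (φ (x, ω)) * g ω * (starRingEnd ℂ) (F x) ∂σ := fun x => by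
      rw [integral_mul_const, Complex.mul_conj, Complex.normSq_eq_norm_sq]
    rw [← integral_complex_ofReal]
    simp_rw [this]
    rw [integral_integral_swap]
    · congr 1; ext ω
      rw [hHdef]
      simp only [← integral_conj, ← integral_const_mul, map_mul, star_unitExp, neg_neg]
      congr 1; ext x; ring
    · refine integrable_of_measurable_bounded (B := B * B') ?_ fun p => ?_
      · simp only [Function.uncurry_def]
        fun_prop
      · simp only [Function.uncurry_def, norm_mul, norm_unitExp, one_mul, RCLike.norm_conj]
        exact mul_le_mul (hB _) (hB' _) (norm_nonneg _) ((norm_nonneg _).trans (hB p.2))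
  have hBH : ∫ ω, ‖H ω‖ ^ 2 ∂σ ≤ A * ∫ x, ‖F x‖ ^ 2 ∂μ := by
    refine le_trans ?_ (schur_quadratic_form hF hB' hK hKD hKs (A := A) hA)
    have e2 : ((∫ ω, ‖H ω‖ ^ 2 ∂σ : ℝ) : ℂ) =
        ∫ p, F p.1 * (starRingEnd ℂ) (F p.2) * K p ∂(μ.prod μ) := by
      have : ∀ ω, ((‖H ω‖ ^ 2 : ℝ) : ℂ) = ∫ p : X × X, F p.1 * (starRingEnd ℂ) (F p.2) *
          unitExp (φ (p.2, ω) - φ (p.1, ω)) ∂(μ.prod μ) := fun ω => by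
        rw [← Complex.normSq_eq_norm_sq, ← Complex.mul_conj, hHdef]
        simp only [← integral_conj]
        rw [← integral_prod_mul]
        congr 1; ext p
        rw [map_mul, star_unitExp, sub_eq_add_neg, unitExp_add, neg_neg]; ring
      rw [← integral_complex_ofReal]
      simp_rw [this]
      rw [integral_integral_swap]
      · simp_rw [integral_const_mul, hKdef]
      · refine integrable_of_measurable_bounded (B := B' * B') ?_ fun p => ?_
        · simp only [Function.uncurry_def]
          fun_prop
        · simp only [Function.uncurry_def, norm_mul, norm_unitExp, mul_one, RCLike.norm_conj]
          exact mul_le_mul (hB' _) (hB' _) (norm_nonneg _) (hB0 p.2.1)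
    rw [← e2, Complex.norm_real]
    exact le_abs_self _
  have hgi : Integrable (fun ω => ‖g ω‖ ^ 2) σ :=
    integrable_real_of_measurable_bounded (B := B ^ 2) (by fun_prop) fun ω => by
      rw [abs_of_nonneg (by positivity)]
      have := hB ω
      gcongr
  have hHi : Integrable (fun ω => ‖H ω‖ ^ 2) σ :=
    integrable_real_of_measurable_bounded (B := (B' * μ.real univ) ^ 2) (by fun_prop) fun ω => by
      rw [abs_of_nonneg (by positivity)]
      have := hHB ω
      gcongr
  have e3 : ∫ x, ‖F x‖ ^ 2 ∂μ ≤
      ∫ ω, (A / 2 * ‖g ω‖ ^ 2 + 1 / (2 * A) * ‖H ω‖ ^ 2) ∂σ := by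
    calc ∫ x, ‖F x‖ ^ 2 ∂μ ≤ ‖((∫ x, ‖F x‖ ^ 2 ∂μ : ℝ) : ℂ)‖ := by
          rw [Complex.norm_real]; exact le_abs_self _
      _ ≤ _ := by
          rw [e1]
          refine norm_integral_le_of_norm_le ((hgi.const_mul _).add (hHi.const_mul _)) ?_
          refine Filter.Eventually.of_forall fun ω => ?_
          rw [norm_mul, RCLike.norm_conj]
          have : A / 2 * ‖g ω‖ ^ 2 + 1 / (2 * A) * ‖H ω‖ ^ 2 - ‖g ω‖ * ‖H ω‖
            = (A * ‖g ω‖ - ‖H ω‖) ^ 2 / (2 * A) := by field_simp; ring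
          have h0 : 0 ≤ (A * ‖g ω‖ - ‖H ω‖) ^ 2 / (2 * A) := by positivity
          linarith
  rw [integral_add (hgi.const_mul _) (hHi.const_mul _), integral_const_mul,
    integral_const_mul] at e3
  have e4 : 1 / (2 * A) * ∫ ω, ‖H ω‖ ^ 2 ∂σ ≤ 1 / (2 * A) * (A * ∫ x, ‖F x‖ ^ 2 ∂μ) := by
    gcongr
  have e5 : 1 / (2 * A) * (A * ∫ x, ‖F x‖ ^ 2 ∂μ) = (∫ x, ‖F x‖ ^ 2 ∂μ) / 2 := by
    field_simp
  linarith

end TTStar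

section SineIntegral

/-- The oscillatory integral `∫₀^π sin^m θ cos^k θ e(R cos θ) dθ`. -/
def sineOsc (m k : ℕ) (R : ℝ) : ℂ :=
  ∫ θ in (0 : ℝ)..π, ((sin θ ^ m * cos θ ^ k : ℝ) : ℂ) * unitExp (R * cos θ)

lemma hasDerivAt_unitExp_mul_cos (R θ : ℝ) :
    HasDerivAt (fun θ => unitExp (R * cos θ))
      (-(2 * π * R * sin θ : ℝ) * Complex.I * unitExp (R * cos θ)) θ := by
  unfold unitExp
  have h : HasDerivAt (fun θ : ℝ => 2 * π * (R * cos θ)) (2 * π * (R * (-sin θ))) θ :=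
    ((hasDerivAt_cos θ).const_mul R).const_mul (2 * π)
  convert (h.ofReal_comp.mul_const Complex.I).cexp using 1
  push_cast; ring

lemma integral_mul_sin_unitExp (R : ℝ) {a b : ℝ} {v v' : ℝ → ℝ}
    (hv : ∀ θ ∈ uIcc a b, HasDerivAt v (v' θ) θ) (hv' : ContinuousOn v' (uIcc a b)) :
    ((2 * π * R : ℝ) : ℂ) * Complex.I *
      ∫ θ in a..b, ((v θ * sin θ : ℝ) : ℂ) * unitExp (R * cos θ) =
    (v a : ℂ) * unitExp (R * cos a) - (v b : ℂ) * unitExp (R * cos b) +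
      ∫ θ in a..b, (v' θ : ℂ) * unitExp (R * cos θ) := by
  have hu : Continuous fun θ => unitExp (R * cos θ) := by
    have := continuous_unitExp; fun_prop
  have hvc : ContinuousOn v (uIcc a b) := fun x hx => (hv x hx).continuousAt.continuousWithinAt
  have h := intervalIntegral.integral_mul_deriv_eq_deriv_mul (a := a) (b := b)
    (u := fun θ => (v θ : ℂ)) (u' := fun θ => (v' θ : ℂ))
    (v := fun θ => unitExp (R * cos θ))
    (v' := fun θ => -(2 * π * R * sin θ : ℝ) * Complex.I * unitExp (R * cos θ))
    (fun θ hθ => (hv θ hθ).ofReal_comp)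
    (fun θ hθ => hasDerivAt_unitExp_mul_cos R θ)
    (Complex.continuous_ofReal.comp_continuousOn hv').intervalIntegrable
    (by
      have : Continuous fun θ : ℝ => -((2 * π * R * sin θ : ℝ) : ℂ) * Complex.I := by fun_prop
      exact (this.mul hu).intervalIntegrable _ _)
  have h2 : ((2 * π * R : ℝ) : ℂ) * Complex.I *
      ∫ θ in a..b, ((v θ * sin θ : ℝ) : ℂ) * unitExp (R * cos θ) =
      - ∫ θ in a..b, (v θ : ℂ) * (-(2 * π * R * sin θ : ℝ) * Complex.I * unitExp (R * cos θ)) := by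
    rw [← intervalIntegral.integral_const_mul, ← intervalIntegral.integral_neg]
    congr 1; ext θ; push_cast; ring
  rw [h2, h]; ring

lemma norm_integral_mul_sin_unitExp_le {R : ℝ} (hR : 0 < R) {a b : ℝ} (hab : a ≤ b) {v v' w : ℝ → ℝ}
    (hv : ∀ θ ∈ Icc a b, HasDerivAt v (v' θ) θ) (hv' : ContinuousOn v' (Icc a b))
    (hw : IntervalIntegrable w volume a b) (hvw : ∀ θ ∈ Icc a b, |v' θ| ≤ w θ) :
    ‖∫ θ in a..b, ((v θ * sin θ : ℝ) : ℂ) * unitExp (R * cos θ)‖ ≤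
      (|v a| + |v b| + ∫ θ in a..b, w θ) / R := by
  have h := congrArg norm (integral_mul_sin_unitExp R (a := a) (b := b) (v := v) (v' := v')
    (by rwa [uIcc_of_le hab]) (by rwa [uIcc_of_le hab]))
  rw [norm_mul, norm_mul, Complex.norm_I, mul_one, Complex.norm_real, norm_eq_abs,
    abs_of_pos (by positivity)] at h
  have h1 : ‖∫ θ in a..b, (v' θ : ℂ) * unitExp (R * cos θ)‖ ≤ ∫ θ in a..b, w θ := by
    refine intervalIntegral.norm_integral_le_of_norm_le hab ?_ hw
    refine Filter.Eventually.of_forall fun θ hθ => ?_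
    rw [norm_mul, norm_unitExp, mul_one, Complex.norm_real]
    exact hvw θ (Ioc_subset_Icc_self hθ)
  have h2 := norm_add_le ((v a : ℂ) * unitExp (R * cos a) - (v b : ℂ) * unitExp (R * cos b))
    (∫ θ in a..b, (v' θ : ℂ) * unitExp (R * cos θ))
  have h3 := norm_sub_le ((v a : ℂ) * unitExp (R * cos a)) ((v b : ℂ) * unitExp (R * cos b))
  rw [norm_mul, norm_mul, norm_unitExp, norm_unitExp, mul_one, mul_one, Complex.norm_real,
    Complex.norm_real, norm_eq_abs, norm_eq_abs] at h3
  rw [le_div_iff₀ hR]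
  have h4 : ‖∫ θ in a..b, ((v θ * sin θ : ℝ) : ℂ) * unitExp (R * cos θ)‖ * R ≤
      2 * π * R * ‖∫ θ in a..b, ((v θ * sin θ : ℝ) : ℂ) * unitExp (R * cos θ)‖ := by
    have : (1 : ℝ) ≤ 2 * π := by linarith [Real.two_le_pi]
    have h5 := norm_nonneg (∫ θ in a..b, ((v θ * sin θ : ℝ) : ℂ) * unitExp (R * cos θ))
    nlinarith [mul_nonneg h5 hR.le]
  linarith

lemma sineOsc_one_le (k : ℕ) {R : ℝ} (hR : 0 < R) : ‖sineOsc 1 k R‖ ≤ (2 + k * π) / R := by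
  have h := norm_integral_mul_sin_unitExp_le hR pi_pos.le (v := fun θ => cos θ ^ k)
    (v' := fun θ => k * cos θ ^ (k - 1) * (-sin θ)) (w := fun _ => (k : ℝ))
    (fun θ _ => (hasDerivAt_cos θ).pow k) (by fun_prop) (by simp)
    (fun θ _ => by
      rw [abs_mul, abs_mul, abs_pow, abs_neg, Nat.abs_cast]
      calc (k : ℝ) * |cos θ| ^ (k - 1) * |sin θ| ≤ k * 1 ^ (k - 1) * 1 := by
            gcongr
            · exact abs_cos_le_one θ
            · exact abs_sin_le_one θ
        _ = k := by simp)
  refine le_trans (le_of_eq ?_) (h.trans (le_of_eq ?_))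
  · simp only [sineOsc, pow_one, mul_comm (sin _)]
  · simp; ring

lemma sineOsc_add_two (m k : ℕ) {R : ℝ} (hR : 0 < R) :
    ‖sineOsc (m + 2) k R‖ ≤ ((m + 1) * ‖sineOsc m (k + 1) R‖ + k * ‖sineOsc (m + 2) (k - 1) R‖) / R := by
  have h := congrArg norm (integral_mul_sin_unitExp R (a := 0) (b := π)
    (v := fun θ => sin θ ^ (m + 1) * cos θ ^ k)
    (v' := fun θ => (↑(m + 1) * sin θ ^ m * cos θ) * cos θ ^ k +
      sin θ ^ (m + 1) * (k * cos θ ^ (k - 1) * (-sin θ)))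
    (fun θ _ => ((hasDerivAt_sin θ).pow (m + 1)).mul ((hasDerivAt_cos θ).pow k)) (by fun_prop))
  have hu : Continuous fun θ => unitExp (R * cos θ) := by
    have := continuous_unitExp; fun_prop
  have hi : ∀ m k : ℕ, IntervalIntegrable
      (fun θ => ((sin θ ^ m * cos θ ^ k : ℝ) : ℂ) * unitExp (R * cos θ)) volume 0 π := fun m k => by
    apply Continuous.intervalIntegrable
    fun_prop
  have e1 : ∫ θ in (0 : ℝ)..π, ((sin θ ^ (m + 1) * cos θ ^ k * sin θ : ℝ) : ℂ) *
      unitExp (R * cos θ) = sineOsc (m + 2) k R := by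
    unfold sineOsc
    congr 1; ext θ; push_cast; ring
  have e2 : ∫ θ in (0 : ℝ)..π, (((↑(m + 1) * sin θ ^ m * cos θ) * cos θ ^ k +
      sin θ ^ (m + 1) * (k * cos θ ^ (k - 1) * (-sin θ)) : ℝ) : ℂ) * unitExp (R * cos θ) =
      (m + 1) * sineOsc m (k + 1) R - k * sineOsc (m + 2) (k - 1) R := by
    unfold sineOsc
    rw [← intervalIntegral.integral_const_mul, ← intervalIntegral.integral_const_mul,
      ← intervalIntegral.integral_sub ((hi _ _).const_mul _) ((hi _ _).const_mul _)]
    congr 1; ext θ; push_cast; ring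
  rw [e1, e2] at h
  simp only [sin_zero, sin_pi, ne_eq, Nat.add_eq_zero_iff, one_ne_zero, and_false,
    not_false_eq_true, zero_pow, zero_mul, Complex.ofReal_zero, sub_zero, zero_add] at h
  rw [norm_mul, norm_mul, Complex.norm_I, mul_one, Complex.norm_real, norm_eq_abs,
    abs_of_pos (by positivity)] at h
  have h2 := norm_sub_le ((m + 1) * sineOsc m (k + 1) R) (k * sineOsc (m + 2) (k - 1) R)
  have h3 : ‖((m : ℂ) + 1)‖ = m + 1 := by exact_mod_cast Complex.norm_natCast (m + 1)
  rw [norm_mul, norm_mul, h3, Complex.norm_natCast] at h2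
  rw [le_div_iff₀ hR]
  have : (1 : ℝ) ≤ 2 * π := by linarith [Real.two_le_pi]
  nlinarith [mul_nonneg (norm_nonneg (sineOsc (m + 2) k R)) hR.le]

lemma sineOsc_zero_le (k : ℕ) {R : ℝ} (hR : 1 ≤ R) :
    ‖sineOsc 0 k R‖ ≤ (2 + 2 * π + k * π) * R ^ (-(1 / 2) : ℝ) := by
  have hR0 : 0 < R := by linarith
  set δ := R ^ (-(1 / 2) : ℝ) with hδ
  have hδ0 : 0 < δ := by positivity
  have hδ1 : δ ≤ 1 := rpow_le_one_of_one_le_of_nonpos hR (by norm_num)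
  have hRδ : R⁻¹ = δ * δ := by
    rw [hδ, ← rpow_add hR0, ← rpow_neg_one]; norm_num
  have hπ := Real.two_le_pi
  have hu : Continuous fun θ => unitExp (R * cos θ) := by
    have := continuous_unitExp; fun_prop
  set G : ℝ → ℂ := fun θ => ((sin θ ^ 0 * cos θ ^ k : ℝ) : ℂ) * unitExp (R * cos θ) with hG
  have hGc : Continuous G := by fun_prop
  have hGb : ∀ θ, ‖G θ‖ ≤ 1 := fun θ => by
    rw [hG]
    simp only [norm_mul, norm_unitExp, Complex.norm_real, pow_zero, one_mul, mul_one, norm_pow]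
    exact pow_le_one₀ (norm_nonneg _) (abs_cos_le_one θ)
  have hsin : ∀ θ ∈ Icc δ (π - δ), 0 < sin θ := fun θ hθ =>
    sin_pos_of_pos_of_lt_pi (by linarith [hθ.1]) (by linarith [hθ.2])
  have hsplit : sineOsc 0 k R = (∫ θ in 0..δ, G θ) + (∫ θ in δ..(π - δ), G θ) +
      ∫ θ in (π - δ)..π, G θ := by
    rw [intervalIntegral.integral_add_adjacent_intervals (hGc.intervalIntegrable _ _)
      (hGc.intervalIntegrable _ _), intervalIntegral.integral_add_adjacent_intervals
      (hGc.intervalIntegrable _ _) (hGc.intervalIntegrable _ _)]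
    rfl
  have h1 : ‖∫ θ in 0..δ, G θ‖ ≤ δ := by
    have := intervalIntegral.norm_integral_le_of_norm_le_const (a := 0) (b := δ) (f := G) (C := 1)
      (fun θ _ => hGb θ)
    simpa [abs_of_pos hδ0] using this
  have h3 : ‖∫ θ in (π - δ)..π, G θ‖ ≤ δ := by
    have := intervalIntegral.norm_integral_le_of_norm_le_const (a := π - δ) (b := π) (f := G)
      (C := 1) (fun θ _ => hGb θ)
    simpa [abs_of_pos hδ0] using this
  have hcot : ∀ θ ∈ uIcc δ (π - δ), HasDerivAt (fun θ => k * θ - cos θ / sin θ)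
      ((k : ℝ) + 1 / sin θ ^ 2) θ := fun θ hθ => by
    rw [uIcc_of_le (by linarith)] at hθ
    have hs := (hsin θ hθ).ne'
    refine (((hasDerivAt_id θ).const_mul (k : ℝ)).sub
      ((hasDerivAt_cos θ).div (hasDerivAt_sin θ) hs)).congr_deriv ?_
    have := sin_sq_add_cos_sq θ
    field_simp
    linarith
  have hwc : ContinuousOn (fun θ => (k : ℝ) + 1 / sin θ ^ 2) (Icc δ (π - δ)) := by
    refine continuousOn_const.add (continuousOn_const.div (by fun_prop) fun θ hθ => ?_)
    exact pow_ne_zero _ (hsin θ hθ).ne'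
  have hle : δ ≤ π - δ := by linarith
  have hw : IntervalIntegrable (fun θ => (k : ℝ) + 1 / sin θ ^ 2) volume δ (π - δ) :=
    ContinuousOn.intervalIntegrable (by rwa [uIcc_of_le hle])
  have h2 := norm_integral_mul_sin_unitExp_le hR0 hle
    (v := fun θ => cos θ ^ k / sin θ)
    (v' := fun θ => (k * cos θ ^ (k - 1) * (-sin θ) * sin θ - cos θ ^ k * cos θ) / sin θ ^ 2)
    (w := fun θ => (k : ℝ) + 1 / sin θ ^ 2)
    (fun θ hθ => ((hasDerivAt_cos θ).pow k).div (hasDerivAt_sin θ) (hsin θ hθ).ne')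
    (ContinuousOn.div (by fun_prop) (by fun_prop) fun θ hθ => pow_ne_zero _ (hsin θ hθ).ne')
    hw
    (fun θ hθ => by
      have hs := hsin θ hθ
      rw [abs_div, abs_of_pos (pow_pos hs 2), div_le_iff₀ (by positivity)]
      have e : ((k : ℝ) + 1 / sin θ ^ 2) * sin θ ^ 2 = k * sin θ ^ 2 + 1 := by
        field_simp
      rw [e]
      refine (abs_sub _ _).trans (add_le_add ?_ ?_)
      · simp only [abs_mul, abs_neg, abs_pow, Nat.abs_cast, abs_of_pos hs]
        calc (k : ℝ) * |cos θ| ^ (k - 1) * sin θ * sin θ ≤ k * 1 ^ (k - 1) * sin θ * sin θ := by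
              gcongr; exact abs_cos_le_one θ
          _ = k * sin θ ^ 2 := by simp; ring
      · rw [← pow_succ, abs_pow]
        exact pow_le_one₀ (abs_nonneg _) (abs_cos_le_one θ))
  have eG : ∫ θ in δ..(π - δ), ((cos θ ^ k / sin θ * sin θ : ℝ) : ℂ) * unitExp (R * cos θ) =
      ∫ θ in δ..(π - δ), G θ := by
    refine intervalIntegral.integral_congr fun θ hθ => ?_
    rw [uIcc_of_le hle] at hθ
    simp only [hG]
    rw [div_mul_cancel₀ _ (hsin θ hθ).ne', pow_zero, one_mul]
  rw [eG, intervalIntegral.integral_eq_sub_of_hasDerivAt hcot hw] at h2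
  have hsδ : 2 / π * δ ≤ sin δ := mul_le_sin hδ0.le (by linarith)
  have hsδ0 : 0 < sin δ := hsin δ ⟨le_rfl, hle⟩
  have hinv : 1 / sin δ ≤ π / 2 / δ := by
    rw [div_le_div_iff₀ hsδ0 hδ0]
    have : π / 2 * (2 / π * δ) = δ := by field_simp
    nlinarith [mul_le_mul_of_nonneg_left hsδ (by positivity : (0 : ℝ) ≤ π / 2)]
  have hb : |cos δ ^ k / sin δ| ≤ 1 / sin δ := by
    rw [abs_div, abs_of_pos hsδ0, abs_pow]
    gcongr
    exact pow_le_one₀ (abs_nonneg _) (abs_cos_le_one δ)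
  have hc : cos δ / sin δ ≤ 1 / sin δ := by gcongr; exact cos_le_one δ
  have h2' : ‖∫ θ in δ..(π - δ), G θ‖ ≤ (2 * π + k * π) * δ := by
    refine h2.trans ?_
    rw [div_eq_mul_inv, hRδ]
    simp only [sin_pi_sub, cos_pi_sub]
    have hb2 : |(-cos δ) ^ k / sin δ| ≤ 1 / sin δ := by
      rw [abs_div, abs_of_pos hsδ0, abs_pow, abs_neg]
      gcongr
      exact pow_le_one₀ (abs_nonneg _) (abs_cos_le_one δ)
    have hneg : -cos δ / sin δ = -(cos δ / sin δ) := neg_div _ _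
    rw [hneg]
    have hsum : |cos δ ^ k / sin δ| + |(-cos δ) ^ k / sin δ| +
        (k * (π - δ) - -(cos δ / sin δ) - (k * δ - cos δ / sin δ)) ≤ 4 * (π / 2 / δ) + k * π := by
      have : (0 : ℝ) ≤ k * δ := by positivity
      linarith
    calc _ ≤ (4 * (π / 2 / δ) + k * π) * (δ * δ) := by gcongr
      _ = 2 * π * δ + k * π * δ * δ := by field_simp; ring
      _ ≤ 2 * π * δ + k * π * δ * 1 := by gcongr
      _ = _ := by ring
  rw [hsplit]
  refine (norm_add₃_le).trans ?_
  linarith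

/-- Decay of `∫₀^π sin^m θ cos^k θ e(R cos θ) dθ` for large `R`. -/
theorem sineOsc_decay (m : ℕ) :
    ∀ k, ∃ C : ℝ, 0 ≤ C ∧ ∀ R : ℝ, 1 ≤ R → ‖sineOsc m k R‖ ≤ C * R ^ (-((m : ℝ) + 1) / 2) := by
  induction m using Nat.twoStepInduction with
  | zero =>
    intro k
    refine ⟨2 + 2 * π + k * π, by positivity, fun R hR => (sineOsc_zero_le k hR).trans (le_of_eq ?_)⟩
    norm_num
  | one =>
    intro k
    refine ⟨2 + k * π, by positivity, fun R hR => ?_⟩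
    refine (sineOsc_one_le k (by linarith)).trans (le_of_eq ?_)
    rw [div_eq_mul_inv, ← rpow_neg_one]
    norm_num
  | more m ih _ =>
    have key : ∀ R : ℝ, 1 ≤ R → R ^ (-((m : ℝ) + 1) / 2) / R = R ^ (-((m + 2 : ℕ) + 1 : ℝ) / 2) :=
      fun R hR => by
        rw [div_eq_mul_inv, ← rpow_neg_one, ← rpow_add (by linarith)]
        congr 1; push_cast; ring
    have hstep : ∀ k (D : ℝ), 0 ≤ D → (∀ R : ℝ, 1 ≤ R →
        k * ‖sineOsc (m + 2) (k - 1) R‖ ≤ D * R ^ (-((m + 2 : ℕ) + 1 : ℝ) / 2)) →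
        ∃ C : ℝ, 0 ≤ C ∧ ∀ R : ℝ, 1 ≤ R →
          ‖sineOsc (m + 2) k R‖ ≤ C * R ^ (-((m + 2 : ℕ) + 1 : ℝ) / 2) := by
      intro k D hD0 hD
      obtain ⟨C, hC0, hC⟩ := ih (k + 1)
      refine ⟨(m + 1) * C + D, by positivity, fun R hR => ?_⟩
      have hR0 : 0 < R := by linarith
      refine (sineOsc_add_two m k hR0).trans ?_
      calc _ ≤ ((m + 1) * (C * R ^ (-((m : ℝ) + 1) / 2)) +
            D * R ^ (-((m + 2 : ℕ) + 1 : ℝ) / 2)) / R := by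
              have := hC R hR; have := hD R hR; gcongr
        _ = (m + 1) * C * (R ^ (-((m : ℝ) + 1) / 2) / R) +
            D * R ^ (-((m + 2 : ℕ) + 1 : ℝ) / 2) / R := by ring
        _ ≤ (m + 1) * C * R ^ (-((m + 2 : ℕ) + 1 : ℝ) / 2) +
            D * R ^ (-((m + 2 : ℕ) + 1 : ℝ) / 2) := by
              rw [key R hR]
              gcongr
              exact div_le_self (by positivity) hR
        _ = _ := by ring
    intro k
    induction k with
    | zero => exact hstep 0 0 le_rfl (by simp)
    | succ k ihk =>
      obtain ⟨C, hC0, hC⟩ := ihk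
      refine hstep (k + 1) ((k + 1) * C) (by positivity) fun R hR => ?_
      have := hC R hR
      rw [Nat.add_sub_cancel, mul_assoc]
      push_cast at *
      gcongr

end SineIntegral

section Sphere

/-- The Fourier transform of the surface measure of the unit sphere. -/
def sphereFT {n : ℕ} (z : E n) : ℂ :=
  ∫ ω : sphere (0 : E n) 1, unitExp ⟪z, (ω : E n)⟫ ∂(volume : Measure (E n)).toSphere

/-- The radial measure `r^{n-1} dr` in polar coordinates on `E n`. -/
abbrev radialMeasure (n : ℕ) : Measure (Ioi (0 : ℝ)) := Measure.volumeIoiPow (n - 1)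

lemma measurePreserving_polar (n : ℕ) :
    MeasurePreserving (homeomorphUnitSphereProd (E n)) ((volume : Measure (E n)).comap (↑))
      ((volume : Measure (E n)).toSphere.prod (radialMeasure n)) := by
  have h := (volume : Measure (E n)).measurePreserving_homeomorphUnitSphereProd
  rwa [finrank_euclideanSpace_fin] at h

lemma homeomorphUnitSphereProd_smul {n : ℕ} (x : ({0}ᶜ : Set (E n))) :
    ((homeomorphUnitSphereProd (E n) x).2 : ℝ) • ((homeomorphUnitSphereProd (E n) x).1 : E n) = x :=
  congrArg Subtype.val ((homeomorphUnitSphereProd (E n)).symm_apply_apply x)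

lemma lintegral_polar {n : ℕ} [Nontrivial (E n)] (F : E n → ℝ≥0∞) (hF : Measurable F) :
    ∫⁻ x, F x = ∫⁻ p : sphere (0 : E n) 1 × Ioi (0 : ℝ), F ((p.2 : ℝ) • (p.1 : E n))
      ∂((volume : Measure (E n)).toSphere.prod (radialMeasure n)) := by
  rw [← (measurePreserving_polar n).lintegral_comp (by fun_prop)]
  simp_rw [homeomorphUnitSphereProd_smul]
  rw [lintegral_subtype_comap (measurableSet_singleton _).compl, restrict_compl_singleton]

lemma integral_polar {n : ℕ} [Nontrivial (E n)] (F : E n → ℂ) :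
    ∫ x, F x = ∫ p : sphere (0 : E n) 1 × Ioi (0 : ℝ), F ((p.2 : ℝ) • (p.1 : E n))
      ∂((volume : Measure (E n)).toSphere.prod (radialMeasure n)) := by
  rw [← (measurePreserving_polar n).integral_comp (Homeomorph.measurableEmbedding _)]
  simp_rw [homeomorphUnitSphereProd_smul]
  rw [integral_subtype_comap (measurableSet_singleton _).compl, restrict_compl_singleton]

lemma integrable_polar {n : ℕ} [Nontrivial (E n)] {F : E n → ℂ} (hF : Integrable F) :
    Integrable (fun p : sphere (0 : E n) 1 × Ioi (0 : ℝ) => F ((p.2 : ℝ) • (p.1 : E n)))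
      ((volume : Measure (E n)).toSphere.prod (radialMeasure n)) := by
  rw [← (measurePreserving_polar n).integrable_comp_emb (Homeomorph.measurableEmbedding _)]
  simp only [Function.comp_def, homeomorphUnitSphereProd_smul]
  rw [← Function.comp_def F, ← integrableOn_iff_comap_subtypeVal (measurableSet_singleton _).compl]
  exact hF.integrableOn

/-- The integral over the unit ball of the function homogeneous of degree `0` which agrees with
`e(⟨z, ·⟩)` on the unit sphere. -/
def ballOsc {n : ℕ} (z : E n) : ℂ :=
  ∫ x, (ball (0 : E n) 1).indicator (fun x => unitExp (⟪z, x⟫ / ‖x‖)) x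

lemma ballOsc_eq {n : ℕ} [Nontrivial (E n)] (z : E n) :
    ballOsc z = sphereFT z * ((radialMeasure n).real (Iio ⟨1, mem_Ioi.2 zero_lt_one⟩) : ℂ) := by
  rw [ballOsc, integral_polar]
  have : ∀ p : sphere (0 : E n) 1 × Ioi (0 : ℝ), (ball (0 : E n) 1).indicator
      (fun x => unitExp (⟪z, x⟫ / ‖x‖)) ((p.2 : ℝ) • (p.1 : E n)) =
      unitExp ⟪z, (p.1 : E n)⟫ *
        (Iio (⟨1, mem_Ioi.2 zero_lt_one⟩ : Ioi (0 : ℝ))).indicator (fun _ => (1 : ℂ)) p.2 := by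
    rintro ⟨⟨ω, hω⟩, ⟨r, hr⟩⟩
    have hr' : (0 : ℝ) < r := hr
    have hω' : ‖ω‖ = 1 := by simpa using hω
    have hn : ‖r • ω‖ = r := by rw [norm_smul, hω', mul_one, norm_of_nonneg hr'.le]
    by_cases h : r < 1
    · rw [indicator_of_mem, indicator_of_mem, mul_one, hn, inner_smul_right, mul_div_cancel_left₀ _ hr'.ne']
      · exact h
      · rw [mem_ball_zero_iff, hn]; exact h
    · rw [indicator_of_notMem, indicator_of_notMem, mul_zero]
      · exact h
      · rw [mem_ball_zero_iff, hn]; exact h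
  simp_rw [this]
  rw [integral_prod_mul (fun ω : sphere (0 : E n) 1 => unitExp ⟪z, (ω : E n)⟫)]
  rw [integral_indicator measurableSet_Iio]
  simp [sphereFT]

lemma ballOsc_linearIsometryEquiv {n : ℕ} (L : E n ≃ₗᵢ[ℝ] E n) (z : E n) :
    ballOsc (L z) = ballOsc z := by
  rw [ballOsc, ← L.measurePreserving.integral_comp L.toHomeomorph.measurableEmbedding, ballOsc]
  congr 1; ext x
  by_cases h : ‖x‖ < 1 <;> simp [indicator, h, L.inner_map_map]

/-- Splitting off the first coordinate of a Euclidean space preserves volume. -/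
lemma exists_measurePreserving_split (m : ℕ) :
    ∃ T : E (m + 1) → ℝ × E m, MeasurePreserving T ∧
      ∀ x, (T x).1 = x 0 ∧ ‖x‖ ^ 2 = (T x).1 ^ 2 + ‖(T x).2‖ ^ 2 := by
  refine ⟨_, (((MeasurePreserving.id volume).prod (PiLp.volume_preserving_toLp (Fin m))).comp
    (volume_preserving_piFinSuccAbove (fun _ : Fin (m + 1) => ℝ) 0)).comp
    (PiLp.volume_preserving_ofLp (Fin (m + 1))), fun x => ⟨rfl, ?_⟩⟩
  rw [EuclideanSpace.norm_sq_eq, EuclideanSpace.norm_sq_eq, Fin.sum_univ_succ]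
  simp [MeasurableEquiv.piFinSuccAbove, Function.comp_def, Fin.insertNthEquiv, Fin.tail]

/-- The integrand of `ballOsc` in cylindrical coordinates. -/
def cylKernel (R : ℝ) (p : ℝ × ℝ) : ℂ :=
  ({p : ℝ × ℝ | p.1 ^ 2 + p.2 ^ 2 < 1}).indicator
    (fun p => unitExp (R * p.1 / √(p.1 ^ 2 + p.2 ^ 2))) p

lemma measurable_cylKernel (R : ℝ) : Measurable (cylKernel R) := by
  refine Measurable.indicator (by fun_prop) ?_
  exact measurableSet_lt (by fun_prop) (by fun_prop)

lemma norm_cylKernel_le (R : ℝ) (p : ℝ × ℝ) : ‖cylKernel R p‖ ≤ 1 := by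
  refine (norm_indicator_le_norm_self _ _).trans ?_
  rw [norm_unitExp]

lemma ballOsc_single_eq_integral_cyl (m : ℕ) (R : ℝ) :
    ballOsc (EuclideanSpace.single (0 : Fin (m + 2)) R) =
      (((m + 1 : ℕ) * (volume : Measure (E (m + 1))).real (ball 0 1) : ℝ) : ℂ) *
        ∫ s : ℝ, ∫ ρ in Ioi (0 : ℝ), (ρ : ℂ) ^ m * cylKernel R (s, ρ) := by
  obtain ⟨T, hT, hT'⟩ := exists_measurePreserving_split (m + 1)
  have hkey : ∀ x : E (m + 2), (ball (0 : E (m + 2)) 1).indicator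
      (fun x => unitExp (⟪EuclideanSpace.single (0 : Fin (m + 2)) R, x⟫ / ‖x‖)) x =
      cylKernel R ((T x).1, ‖(T x).2‖) := fun x => by
    obtain ⟨h1, h2⟩ := hT' x
    have h3 : ⟪EuclideanSpace.single (0 : Fin (m + 2)) R, x⟫ = R * (T x).1 := by
      rw [EuclideanSpace.inner_single_left, h1]; simp
    have h4 : (x ∈ ball (0 : E (m + 2)) 1) ↔ (T x).1 ^ 2 + ‖(T x).2‖ ^ 2 < 1 := by
      rw [mem_ball_zero_iff, ← h2, sq_lt_one_iff₀ (norm_nonneg _)]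
    simp only [cylKernel, indicator, mem_ofPred_eq, h4, h3, ← h2, sqrt_sq (norm_nonneg x)]
  have hmeas : Measurable fun q : ℝ × E (m + 1) => cylKernel R (q.1, ‖q.2‖) :=
    (measurable_cylKernel R).comp (by fun_prop)
  have hint0 : Integrable (fun x : E (m + 2) => cylKernel R ((T x).1, ‖(T x).2‖)) := by
    simp_rw [← hkey]
    rw [integrable_indicator_iff measurableSet_ball]
    refine Measure.integrableOn_of_bounded (M := 1) measure_ball_lt_top.ne ?_ ?_
    · exact Measurable.aestronglyMeasurable (by fun_prop)
    · exact Filter.Eventually.of_forall fun x => (norm_unitExp _).le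
  have hint : Integrable (fun q : ℝ × E (m + 1) => cylKernel R (q.1, ‖q.2‖)) :=
    (hT.integrable_comp hmeas.aestronglyMeasurable).1 hint0
  rw [ballOsc]
  simp_rw [hkey]
  have e := integral_map (μ := volume) hT.measurable.aemeasurable
    (f := fun q : ℝ × E (m + 1) => cylKernel R (q.1, ‖q.2‖)) hmeas.aestronglyMeasurable
  rw [hT.map_eq] at e
  rw [← e, Measure.volume_eq_prod, integral_prod _ hint, ← integral_const_mul]
  congr 1; ext s
  rw [integral_fun_norm_addHaar volume (fun ρ => cylKernel R (s, ρ)), finrank_euclideanSpace_fin]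
  simp only [nsmul_eq_mul, Complex.real_smul, Nat.add_sub_cancel]
  push_cast
  ring

lemma integral_cyl_eq (m : ℕ) (R : ℝ) :
    ∫ s : ℝ, ∫ ρ in Ioi (0 : ℝ), (ρ : ℂ) ^ m * cylKernel R (s, ρ) =
      (∫ r in Ioi (0 : ℝ), (r : ℂ) ^ (m + 1) * (Iio (1 : ℝ)).indicator 1 r) * sineOsc m 0 R := by
  set f : ℝ × ℝ → ℂ := fun p => (Ioi (0 : ℝ)).indicator (fun ρ => (ρ : ℂ) ^ m) p.2 * cylKernel R p
    with hf
  have hfm : Measurable f := by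
    have h1 : Measurable ((Ioi (0 : ℝ)).indicator (fun ρ => (ρ : ℂ) ^ m)) :=
      Measurable.indicator (by fun_prop) measurableSet_Ioi
    exact (h1.comp measurable_snd).mul (measurable_cylKernel R)
  have hfsupp : ∀ p, p ∉ (ball (0 : ℝ × ℝ) 1) → f p = 0 := by
    intro p hp
    have : cylKernel R p = 0 := by
      refine indicator_of_notMem (fun h => hp ?_) _
      simp only [mem_ofPred_eq] at h
      rw [mem_ball_zero_iff, Prod.norm_def, max_lt_iff, norm_eq_abs, norm_eq_abs,
        ← sq_lt_one_iff_abs_lt_one, ← sq_lt_one_iff_abs_lt_one]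
      constructor <;> nlinarith [sq_nonneg p.1, sq_nonneg p.2]
    simp [hf, this]
  have hfb : ∀ p ∈ ball (0 : ℝ × ℝ) 1, ‖f p‖ ≤ 1 := by
    intro p hp
    rw [mem_ball_zero_iff, Prod.norm_def, max_lt_iff] at hp
    rw [hf]
    simp only [norm_mul]
    refine mul_le_one₀ ?_ (norm_nonneg _) (norm_cylKernel_le R p)
    refine (norm_indicator_le_norm_self _ _).trans ?_
    rw [norm_pow, Complex.norm_real]
    exact pow_le_one₀ (norm_nonneg _) hp.2.le
  have hfi : Integrable f := by
    rw [← integrableOn_iff_integrable_of_support_subset (s := ball (0 : ℝ × ℝ) 1)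
      (fun p hp => by by_contra h; exact hp (hfsupp p h))]
    refine Measure.integrableOn_of_bounded (M := 1) measure_ball_lt_top.ne
      hfm.aestronglyMeasurable ?_
    filter_upwards [ae_restrict_mem measurableSet_ball] with p hp using hfb p hp
  have e1 : ∫ s : ℝ, ∫ ρ in Ioi (0 : ℝ), (ρ : ℂ) ^ m * cylKernel R (s, ρ) = ∫ p, f p := by
    rw [Measure.volume_eq_prod, integral_prod _ hfi]
    congr 1; ext s
    rw [← integral_indicator measurableSet_Ioi]
    congr 1; ext ρ
    by_cases h : ρ ∈ Ioi (0 : ℝ)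
    · simp only [hf, indicator_of_mem h]
    · simp only [hf, indicator_of_notMem h, zero_mul]
  rw [e1, ← integral_comp_polarCoord_symm]
  have e2 : ∀ p ∈ polarCoord.target, p.1 • f (polarCoord.symm p) =
      ((p.1 : ℂ) ^ (m + 1) * (Iio (1 : ℝ)).indicator 1 p.1) *
      ((Ioi (0 : ℝ)).indicator
        (fun θ => ((sin θ ^ m * cos θ ^ 0 : ℝ) : ℂ) * unitExp (R * cos θ)) p.2) := by
    rintro ⟨r, θ⟩ ⟨hr, hθ⟩
    simp only [mem_Ioi] at hr
    simp only [mem_Ioo] at hθ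
    rw [polarCoord_symm_apply]
    have hsq : (r * cos θ) ^ 2 + (r * sin θ) ^ 2 = r ^ 2 := by
      have := sin_sq_add_cos_sq θ
      linear_combination r ^ 2 * this
    simp only [hf, cylKernel, indicator, mem_ofPred_eq, hsq, sqrt_sq hr.le, mem_Ioi, mem_Iio,
      Pi.one_apply, sq_lt_one_iff₀ hr.le, Complex.real_smul]
    have hdiv : R * (r * cos θ) / r = R * cos θ := by field_simp
    rw [hdiv]
    by_cases h1 : 0 < θ
    · have h3 : 0 < r * sin θ := mul_pos hr (sin_pos_of_pos_of_lt_pi h1 hθ.2)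
      rw [if_pos h3, if_pos h1]
      push_cast
      split_ifs <;> ring
    · have h3 : ¬ 0 < r * sin θ := by
        have := sin_nonpos_of_nonpos_of_neg_pi_le (not_lt.1 h1) hθ.1.le
        nlinarith
      rw [if_neg h3, if_neg h1]; simp
  rw [setIntegral_congr_fun polarCoord.open_target.measurableSet e2]
  have e3 : polarCoord.target = Ioi (0 : ℝ) ×ˢ Ioo (-π) π := rfl
  rw [e3, Measure.volume_eq_prod, setIntegral_prod_mul
    (fun r : ℝ => (r : ℂ) ^ (m + 1) * (Iio (1 : ℝ)).indicator 1 r)]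
  congr 1
  have e4 : Ioo (-π) π ∩ Ioi 0 = Ioo 0 π := by
    ext x
    simp only [mem_inter_iff, mem_Ioo, mem_Ioi]
    have := pi_pos
    constructor
    · rintro ⟨⟨_, h⟩, h'⟩; exact ⟨h', h⟩
    · rintro ⟨h, h'⟩; exact ⟨⟨by linarith, h'⟩, h⟩
  rw [setIntegral_indicator measurableSet_Ioi, sineOsc, intervalIntegral.integral_of_le pi_pos.le,
    integral_Ioc_eq_integral_Ioo, e4]

/-- Decay of the Fourier transform of the surface measure of the sphere. -/
theorem sphereFT_decay {n : ℕ} (hn : 2 ≤ n) {a : ℝ} (ha : 0 ≤ a) (ha' : a ≤ ((n : ℝ) - 1) / 2) :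
    ∃ C : ℝ, 0 < C ∧ ∀ z : E n, z ≠ 0 → ‖sphereFT z‖ ≤ C * ‖z‖ ^ (-a) := by
  obtain ⟨m, rfl⟩ : ∃ m, n = m + 2 := ⟨n - 2, by omega⟩
  obtain ⟨C, hC0, hC⟩ := sineOsc_decay m 0
  set V := (volume : Measure (E (m + 2))).toSphere.real univ
  have hV : ∀ z : E (m + 2), ‖sphereFT z‖ ≤ 1 * V := fun z =>
    norm_integral_le_measure_mul fun ω => (norm_unitExp _).le
  set c1 := (radialMeasure (m + 2)).real (Iio ⟨1, mem_Ioi.2 zero_lt_one⟩)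
  have hc1 : 0 < c1 := by
    simp only [c1, radialMeasure, measureReal_def, Measure.volumeIoiPow_apply_Iio]
    rw [ENNReal.toReal_ofReal (by positivity)]
    positivity
  set c2 : ℂ := (((m + 1 : ℕ) * (volume : Measure (E (m + 1))).real (ball 0 1) : ℝ) : ℂ)
  set c3 : ℂ := ∫ r in Ioi (0 : ℝ), (r : ℂ) ^ (m + 1) * (Iio (1 : ℝ)).indicator 1 r
  have hform : ∀ z : E (m + 2), ‖sphereFT z‖ = ‖c2‖ * ‖c3‖ * ‖sineOsc m 0 ‖z‖‖ / c1 := fun z => by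
    obtain ⟨L, hL⟩ : ∃ L : E (m + 2) ≃ₗᵢ[ℝ] E (m + 2),
        L z = EuclideanSpace.single (0 : Fin (m + 2)) ‖z‖ :=
      ⟨_, Submodule.reflection_sub (by simp)⟩
    have h := ballOsc_eq z
    rw [← ballOsc_linearIsometryEquiv L, hL, ballOsc_single_eq_integral_cyl, integral_cyl_eq] at h
    have h' : ‖c2 * (c3 * sineOsc m 0 ‖z‖)‖ = ‖sphereFT z * (c1 : ℂ)‖ := congrArg norm h
    rw [norm_mul, norm_mul, norm_mul, Complex.norm_real c1, norm_of_nonneg hc1.le] at h'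
    rw [eq_div_iff hc1.ne', ← h']; ring
  refine ⟨‖c2‖ * ‖c3‖ * C / c1 + V + 1, by positivity, fun z hz => ?_⟩
  have hz0 : 0 < ‖z‖ := norm_pos_iff.2 hz
  have hp : 0 < ‖z‖ ^ (-a) := by positivity
  have hV0 : 0 ≤ V := measureReal_nonneg
  rcases le_total ‖z‖ 1 with h1 | h1
  · have h2 : 1 ≤ ‖z‖ ^ (-a) := one_le_rpow_of_pos_of_le_one_of_nonpos hz0 h1 (by linarith)
    have h3 : 0 ≤ ‖c2‖ * ‖c3‖ * C / c1 := by positivity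
    nlinarith [hV z, mul_nonneg h3 hp.le, mul_le_mul_of_nonneg_left h2 hV0]
  · rw [hform]
    have h2 : ‖z‖ ^ (-((m : ℝ) + 1) / 2) ≤ ‖z‖ ^ (-a) := by
      refine rpow_le_rpow_of_exponent_le h1 ?_
      push_cast at ha'; linarith
    calc ‖c2‖ * ‖c3‖ * ‖sineOsc m 0 ‖z‖‖ / c1
        ≤ ‖c2‖ * ‖c3‖ * (C * ‖z‖ ^ (-a)) / c1 := by
          have := (hC _ h1).trans (mul_le_mul_of_nonneg_left h2 hC0)
          gcongr
      _ = ‖c2‖ * ‖c3‖ * C / c1 * ‖z‖ ^ (-a) := by ring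
      _ ≤ _ := by gcongr; linarith

end Sphere

section Energy

lemma measure_ball_le_frostman {d : ℕ} (μ : Measure (E d)) (α : ℝ) (x : E d) {r : ℝ} (hr : 0 < r) :
    μ (ball x r) ≤ frostman μ α * ENNReal.ofReal (r ^ α) := by
  have h : μ (ball x r) / ENNReal.ofReal (r ^ α) ≤ frostman μ α :=
    le_iSup_of_le x (le_iSup_of_le r (le_iSup_of_le hr le_rfl))
  rwa [ENNReal.div_le_iff (by simpa using rpow_pos_of_pos hr α) ENNReal.ofReal_ne_top] at h

/-- A dyadic majorant of `|z|^{-a}` on the ball of radius `2`, infinite at the origin. -/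
def dyadicMajorant {n : ℕ} (a : ℝ) (z : E n) : ℝ≥0∞ :=
  ∑' j : ℕ, ENNReal.ofReal (((2 : ℝ) ^ a) ^ j) *
    (ball (0 : E n) (4 * (1 / 2) ^ j)).indicator 1 z

lemma dyadicMajorant_zero {n : ℕ} {a : ℝ} (ha : 0 ≤ a) : dyadicMajorant a (0 : E n) = ⊤ := by
  rw [eq_top_iff, ← ENNReal.tsum_const_eq_top_of_ne_zero (α := ℕ) (c := 1) one_ne_zero]
  refine ENNReal.tsum_le_tsum fun j => ?_
  rw [indicator_of_mem (by simp), Pi.one_apply, mul_one, ENNReal.one_le_ofReal]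
  exact one_le_pow₀ (one_le_rpow (by norm_num) ha)

lemma rpow_neg_le_dyadicMajorant {n : ℕ} {a : ℝ} (ha : 0 ≤ a) {z : E n} (hz : z ≠ 0)
    (hz2 : ‖z‖ < 2) : ENNReal.ofReal (‖z‖ ^ (-a)) ≤ dyadicMajorant a z := by
  have hz0 : 0 < ‖z‖ := norm_pos_iff.2 hz
  obtain ⟨j, hj1, hj2⟩ := exists_nat_pow_near_of_lt_one (x := ‖z‖ / 2) (y := 1 / 2)
    (by positivity) (by linarith) (by norm_num) (by norm_num)
  refine le_trans ?_ (ENNReal.le_tsum j)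
  have hpos : (0 : ℝ) < (1 / 2) ^ j := by positivity
  rw [indicator_of_mem (by rw [mem_ball_zero_iff]; linarith), Pi.one_apply, mul_one]
  apply ENNReal.ofReal_le_ofReal
  have h1 : (1 / 2 : ℝ) ^ j ≤ ‖z‖ := by rw [pow_succ] at hj1; linarith
  calc ‖z‖ ^ (-a) ≤ ((1 / 2 : ℝ) ^ j) ^ (-a) := rpow_le_rpow_of_nonpos hpos h1 (by linarith)
    _ = ((2 : ℝ) ^ a) ^ j := by
      rw [one_div, inv_pow, rpow_neg (by positivity), inv_rpow (by positivity), inv_inv,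
        ← rpow_natCast, ← rpow_natCast, ← rpow_mul (by norm_num), ← rpow_mul (by norm_num),
        mul_comm]

lemma lintegral_dyadicMajorant_le {n : ℕ} (μ : Measure (E n)) {a α : ℝ} (haα : a < α) (x : E n) :
    ∫⁻ y, dyadicMajorant a (y - x) ∂μ ≤
      ENNReal.ofReal ((4 : ℝ) ^ α * (1 - (2 : ℝ) ^ (a - α))⁻¹) * frostman μ α := by
  have hq0 : (0 : ℝ) ≤ 2 ^ (a - α) := by positivity
  have hq1 : (2 : ℝ) ^ (a - α) < 1 := rpow_lt_one_of_one_lt_of_neg (by norm_num) (by linarith)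
  have hmeas : ∀ j : ℕ, Measurable fun y : E n =>
      (ball (0 : E n) (4 * (1 / 2) ^ j)).indicator (1 : E n → ℝ≥0∞) (y - x) := fun j =>
    (measurable_one.indicator measurableSet_ball).comp (measurable_id.sub_const x)
  unfold dyadicMajorant
  rw [lintegral_tsum fun j => ((hmeas j).const_mul _).aemeasurable]
  have hterm : ∀ j : ℕ, ∫⁻ y, ENNReal.ofReal (((2 : ℝ) ^ a) ^ j) *
      (ball (0 : E n) (4 * (1 / 2) ^ j)).indicator 1 (y - x) ∂μ ≤
      ENNReal.ofReal ((4 : ℝ) ^ α * ((2 : ℝ) ^ (a - α)) ^ j) * frostman μ α := fun j => by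
    rw [lintegral_const_mul _ (hmeas j)]
    have e : ∀ y, (ball (0 : E n) (4 * (1 / 2) ^ j)).indicator (1 : E n → ℝ≥0∞) (y - x) =
        (ball x (4 * (1 / 2) ^ j)).indicator 1 y := fun y => by
      simp only [indicator, mem_ball, dist_eq_norm, sub_zero, Pi.one_apply]
    simp_rw [e]
    rw [lintegral_indicator_one measurableSet_ball]
    calc _ ≤ ENNReal.ofReal (((2 : ℝ) ^ a) ^ j) *
          (frostman μ α * ENNReal.ofReal ((4 * (1 / 2) ^ j) ^ α)) := by
            gcongr; exact measure_ball_le_frostman μ α x (by positivity)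
      _ = ENNReal.ofReal (((2 : ℝ) ^ a) ^ j * (4 * (1 / 2) ^ j) ^ α) * frostman μ α := by
            rw [ENNReal.ofReal_mul (by positivity)]; ring
      _ = _ := by
            congr 2
            have h : ((1 / 2 : ℝ) ^ j) ^ α = (((2 : ℝ) ^ α) ^ j)⁻¹ := by
              rw [← rpow_natCast, ← rpow_natCast, ← rpow_mul (by norm_num), mul_comm (j : ℝ) α,
                rpow_mul (by norm_num), one_div, inv_rpow (by norm_num), inv_rpow (by positivity)]
            rw [mul_rpow (by norm_num) (by positivity), h, rpow_sub (by norm_num), div_pow]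
            ring
  refine (ENNReal.tsum_le_tsum hterm).trans (le_of_eq ?_)
  rw [ENNReal.tsum_mul_right, ← ENNReal.ofReal_tsum_of_nonneg (fun j => by positivity)
    ((summable_geometric_of_lt_one hq0 hq1).mul_left _), tsum_mul_left,
    tsum_geometric_of_lt_one hq0 hq1]

lemma enorm_sphereFT_smul_le {n : ℕ} {a C : ℝ} (ha : 0 ≤ a) (hC0 : 0 < C)
    (hC : ∀ z : E n, z ≠ 0 → ‖sphereFT z‖ ≤ C * ‖z‖ ^ (-a)) {r : ℝ} (hr : 0 < r) {z : E n}
    (hz : ‖z‖ < 2) :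
    ‖sphereFT (r • z)‖ₑ ≤ ENNReal.ofReal (C * r ^ (-a)) * dyadicMajorant a z := by
  by_cases h0 : z = 0
  · rw [h0, dyadicMajorant_zero ha, ENNReal.mul_top (by simp; positivity)]
    exact le_top
  · calc ‖sphereFT (r • z)‖ₑ = ENNReal.ofReal ‖sphereFT (r • z)‖ := (ofReal_norm _).symm
      _ ≤ ENNReal.ofReal (C * r ^ (-a) * ‖z‖ ^ (-a)) := by
        apply ENNReal.ofReal_le_ofReal
        refine (hC _ (smul_ne_zero hr.ne' h0)).trans (le_of_eq ?_)
        rw [norm_smul, norm_of_nonneg hr.le, mul_rpow hr.le (norm_nonneg _), mul_assoc]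
      _ = ENNReal.ofReal (C * r ^ (-a)) * ENNReal.ofReal (‖z‖ ^ (-a)) :=
        ENNReal.ofReal_mul (by positivity)
      _ ≤ _ := by gcongr; exact rpow_neg_le_dyadicMajorant ha h0 hz

/-- Fractal energy estimate for the dilated kernel of the surface measure. -/
theorem integral_sphereFT_le {n : ℕ} (hn : 2 ≤ n) {a α : ℝ} (ha : 0 ≤ a) (haα : a < α)
    (hα : α ≤ ((n : ℝ) - 1) / 2) :
    ∃ C : ℝ, 0 < C ∧ ∀ (μ : Measure (E n)) [IsFiniteMeasure μ], μ (ball (0 : E n) 1)ᶜ = 0 →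
      frostman μ α < ⊤ → ∀ r : ℝ, 0 < r →
        ∀ᵐ x ∂μ, ∫ x', ‖sphereFT (r • (x' - x))‖ ∂μ ≤ C * (frostman μ α).toReal * r ^ (-a) := by
  obtain ⟨C, hC0, hC⟩ := sphereFT_decay hn ha (haα.le.trans hα)
  set D := (4 : ℝ) ^ α * (1 - (2 : ℝ) ^ (a - α))⁻¹ with hD
  have hD0 : 0 < D := by
    have hq1 : (2 : ℝ) ^ (a - α) < 1 := rpow_lt_one_of_one_lt_of_neg (by norm_num) (by linarith)
    have : 0 < 1 - (2 : ℝ) ^ (a - α) := by linarith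
    positivity
  refine ⟨C * D, by positivity, fun μ _ hμ hM r hr => ?_⟩
  have hae : ∀ᵐ x ∂μ, x ∈ ball (0 : E n) 1 := mem_ae_iff.2 hμ
  filter_upwards [hae] with x hx
  rw [mem_ball_zero_iff] at hx
  refine (integral_eq_lintegral_of_nonneg_ae (Filter.Eventually.of_forall fun _ => norm_nonneg _)
    ?_).le.trans ?_
  · refine Measurable.aestronglyMeasurable (Measurable.norm ?_)
    exact measurable_integral_right (F := fun p : E n × sphere (0 : E n) 1 =>
      unitExp ⟪r • (p.1 - x), (p.2 : E n)⟫) (by fun_prop)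
  · refine ENNReal.toReal_le_of_le_ofReal (by positivity) ?_
    calc ∫⁻ x', ENNReal.ofReal ‖sphereFT (r • (x' - x))‖ ∂μ
        ≤ ∫⁻ x', ENNReal.ofReal (C * r ^ (-a)) * dyadicMajorant a (x' - x) ∂μ := by
          refine lintegral_mono_ae ?_
          filter_upwards [hae] with y hy
          rw [mem_ball_zero_iff] at hy
          rw [ofReal_norm]
          refine enorm_sphereFT_smul_le ha hC0 hC hr ?_
          linarith [norm_sub_le y x]
      _ = ENNReal.ofReal (C * r ^ (-a)) * ∫⁻ x', dyadicMajorant a (x' - x) ∂μ :=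
          lintegral_const_mul' _ _ ENNReal.ofReal_ne_top
      _ ≤ ENNReal.ofReal (C * r ^ (-a)) * (ENNReal.ofReal D * frostman μ α) := by
          gcongr; exact lintegral_dyadicMajorant_le μ haα x
      _ = ENNReal.ofReal (C * D * (frostman μ α).toReal * r ^ (-a)) := by
          rw [← ENNReal.ofReal_toReal hM.ne, ← ENNReal.ofReal_mul hD0.le,
            ← ENNReal.ofReal_mul (by positivity), ENNReal.toReal_ofReal (by positivity)]
          congr 1; ring

/-- The weighted `L²` estimate for the Fourier extension operator on spheres of radius `r`. -/
theorem lintegral_sphere_extension_le {n : ℕ} {a α : ℝ} {C : ℝ} (hC0 : 0 < C)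
    (μ : Measure (E n)) [IsFiniteMeasure μ] (hμ : μ (ball (0 : E n) 1)ᶜ = 0)
    (hM : frostman μ α < ⊤) {r : ℝ} (hr : 0 < r)
    (hC : ∀ᵐ x ∂μ, ∫ x', ‖sphereFT (r • (x' - x))‖ ∂μ ≤ C * (frostman μ α).toReal * r ^ (-a))
    {g : sphere (0 : E n) 1 → ℂ} (hg : Measurable g) {B : ℝ} (hB : ∀ ω, ‖g ω‖ ≤ B) :
    ∫⁻ x, ‖∫ ω, unitExp ⟪x, r • (ω : E n)⟫ * g ω ∂(volume : Measure (E n)).toSphere‖ₑ ^ 2 ∂μ ≤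
      ENNReal.ofReal (C * (frostman μ α).toReal * r ^ (-a)) *
        ∫⁻ ω, ‖g ω‖ₑ ^ 2 ∂(volume : Measure (E n)).toSphere := by
  by_cases hM0 : frostman μ α = 0
  · have h1 : μ (ball (0 : E n) 1) = 0 := by
      have := measure_ball_le_frostman μ α (0 : E n) one_pos
      rwa [hM0, zero_mul, nonpos_iff_eq_zero] at this
    have h2 : μ = 0 := by
      rw [← Measure.measure_univ_eq_zero, ← union_compl_self (ball (0 : E n) 1)]
      exact measure_union_null h1 hμ
    simp [h2]
  · have hMpos : 0 < (frostman μ α).toReal := ENNReal.toReal_pos hM0 hM.ne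
    set A := C * (frostman μ α).toReal * r ^ (-a)
    have hA0 : 0 < A := by positivity
    have key := oscillatory_TTStar (μ := μ) (σ := (volume : Measure (E n)).toSphere)
      (φ := fun p : E n × sphere (0 : E n) 1 => ⟪p.1, r • (p.2 : E n)⟫) (by fun_prop) hg hB hA0 (by
        filter_upwards [hC] with x hx
        refine le_trans (le_of_eq ?_) hx
        congr 1; ext x'
        rw [sphereFT]
        congr 2; ext ω
        rw [inner_smul_left, inner_sub_left, inner_smul_right, inner_smul_right, ← mul_sub]
        rfl)
    set G : E n → ℂ := fun x =>
      ∫ ω, unitExp ⟪x, r • (ω : E n)⟫ * g ω ∂(volume : Measure (E n)).toSphere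
    have hG : Measurable G :=
      measurable_integral_right (F := fun p : E n × sphere (0 : E n) 1 =>
        unitExp ⟪p.1, r • (p.2 : E n)⟫ * g p.2) (by fun_prop)
    have hGB : ∀ x, ‖G x‖ ≤ B * (volume : Measure (E n)).toSphere.real univ := fun x =>
      norm_integral_le_measure_mul fun ω => by rw [norm_mul, norm_unitExp, one_mul]; exact hB ω
    have conv : ∀ w : ℂ, ‖w‖ₑ ^ 2 = ENNReal.ofReal (‖w‖ ^ 2) := fun w => by
      rw [ENNReal.ofReal_pow (norm_nonneg _), ofReal_norm]
    have hGi : Integrable (fun x => ‖G x‖ ^ 2) μ :=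
      integrable_real_of_measurable_bounded
        (B := (B * (volume : Measure (E n)).toSphere.real univ) ^ 2) (by fun_prop) fun x => by
        rw [abs_of_nonneg (by positivity)]
        have := hGB x
        gcongr
    have hgi : Integrable (fun ω => ‖g ω‖ ^ 2) (volume : Measure (E n)).toSphere :=
      integrable_real_of_measurable_bounded (B := B ^ 2) (by fun_prop) fun ω => by
        rw [abs_of_nonneg (by positivity)]
        have := hB ω
        gcongr
    change ∫⁻ x, ‖G x‖ₑ ^ 2 ∂μ ≤ _
    simp_rw [conv]
    rw [← ofReal_integral_eq_lintegral_ofReal hGi (Filter.Eventually.of_forall fun _ => by positivity),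
      ← ofReal_integral_eq_lintegral_ofReal hgi (Filter.Eventually.of_forall fun _ => by positivity),
      ← ENNReal.ofReal_mul hA0.le]
    exact ENNReal.ofReal_le_ofReal key

end Energy

section Assembly

lemma sq_lintegral_le {X : Type*} [MeasurableSpace X] {ν : Measure X} {W f : X → ℝ≥0∞}
    (hW : Measurable W) (hf : Measurable f) (hW0 : ∀ x, W x ≠ 0) (hWt : ∀ x, W x ≠ ⊤) :
    (∫⁻ x, f x ∂ν) ^ 2 ≤ (∫⁻ x, (W x)⁻¹ ∂ν) * ∫⁻ x, W x * f x ^ 2 ∂ν := by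
  have h := ENNReal.lintegral_mul_le_Lp_mul_Lq ν Real.HolderConjugate.two_two
    (f := fun x => (W x)⁻¹ ^ (1 / 2 : ℝ)) (g := fun x => (W x) ^ (1 / 2 : ℝ) * f x)
    (by fun_prop) (by fun_prop)
  have e1 : ∀ x, ((fun x => (W x)⁻¹ ^ (1 / 2 : ℝ)) * fun x => (W x) ^ (1 / 2 : ℝ) * f x) x = f x :=
    fun x => by
      rw [Pi.mul_apply, ← mul_assoc, ← ENNReal.mul_rpow_of_nonneg _ _ (by norm_num),
        ENNReal.inv_mul_cancel (hW0 x) (hWt x), ENNReal.one_rpow, one_mul]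
  have e2 : ∀ y : ℝ≥0∞, (y ^ (1 / 2 : ℝ)) ^ (2 : ℝ) = y := fun y => by
    rw [← ENNReal.rpow_mul]; norm_num
  have e3 : ∀ x, (W x ^ (1 / 2 : ℝ) * f x) ^ (2 : ℝ) = W x * f x ^ 2 := fun x => by
    rw [ENNReal.mul_rpow_of_nonneg _ _ (by norm_num), e2, ENNReal.rpow_two]
  simp_rw [e1, e2, e3] at h
  calc (∫⁻ x, f x ∂ν) ^ 2 = (∫⁻ x, f x ∂ν) ^ (2 : ℝ) := (ENNReal.rpow_two _).symm
    _ ≤ _ := ENNReal.rpow_le_rpow h (by norm_num)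
    _ = _ := by rw [ENNReal.mul_rpow_of_nonneg _ _ (by norm_num), e2, e2]

/-- The weight `(1 + r²)^s r^a`. -/
def radialWeight (s a r : ℝ) : ℝ := (1 + r ^ 2) ^ s * r ^ a

lemma radialWeight_pos (s a : ℝ) {r : ℝ} (hr : 0 < r) : 0 < radialWeight s a r :=
  mul_pos (rpow_pos_of_pos (by positivity) _) (rpow_pos_of_pos hr _)

@[fun_prop]
lemma measurable_radialWeight (s a : ℝ) : Measurable (radialWeight s a) := by
  unfold radialWeight; fun_prop

lemma lintegral_inv_radialWeight_lt_top {n : ℕ} (hn : 2 ≤ n) {s a : ℝ} (hs : 0 ≤ s)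
    (ha : a < n) (hsa : (n : ℝ) - 2 * s < a) :
    ∫⁻ r : Ioi (0 : ℝ), (ENNReal.ofReal (radialWeight s a r))⁻¹ ∂(radialMeasure n) < ⊤ := by
  rw [radialMeasure, Measure.volumeIoiPow, lintegral_withDensity_eq_lintegral_mul _ (by fun_prop)
    (by fun_prop)]
  simp only [Pi.mul_apply]
  rw [lintegral_subtype_comap measurableSet_Ioi (fun r : ℝ => ENNReal.ofReal (r ^ (n - 1)) *
    (ENNReal.ofReal (radialWeight s a r))⁻¹), ← Ioc_union_Ioi_eq_Ioi (zero_le_one (α := ℝ))]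
  have hpow : ∀ r : ℝ, 0 < r → r ^ (n - 1) = r ^ ((n : ℝ) - 1) := fun r hr => by
    rw [← rpow_natCast, Nat.cast_sub (by omega), Nat.cast_one]
  have hle : ∀ r b : ℝ, 0 < r → r ^ b ≤ (1 + r ^ 2) ^ s →
      ENNReal.ofReal (r ^ (n - 1)) * (ENNReal.ofReal (radialWeight s a r))⁻¹ ≤
        ENNReal.ofReal (r ^ ((n : ℝ) - 1 - a - b)) := fun r b hr hb => by
    rw [← ENNReal.ofReal_inv_of_pos (radialWeight_pos s a hr), ← ENNReal.ofReal_mul (by positivity)]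
    apply ENNReal.ofReal_le_ofReal
    have hb0 : 0 < r ^ b := rpow_pos_of_pos hr _
    have ha0 : 0 < r ^ a := rpow_pos_of_pos hr _
    rw [rpow_sub hr, rpow_sub hr, hpow r hr, radialWeight, div_div, div_eq_mul_inv, mul_comm (r ^ a)]
    gcongr
  refine (lintegral_union_le _ _ _).trans_lt (ENNReal.add_lt_top.2 ⟨?_, ?_⟩)
  · have hi : IntegrableOn (fun r : ℝ => r ^ ((n : ℝ) - 1 - a - 0)) (Ioc 0 1) :=
      (intervalIntegrable_iff_integrableOn_Ioc_of_le zero_le_one).1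
        (intervalIntegral.intervalIntegrable_rpow' (by linarith))
    refine (setLIntegral_mono' measurableSet_Ioc fun r hr => hle r 0 hr.1 ?_).trans_lt
      hi.lintegral_lt_top
    rw [rpow_zero]
    exact one_le_rpow (by nlinarith [sq_nonneg r]) hs
  · have hi : IntegrableOn (fun r : ℝ => r ^ ((n : ℝ) - 1 - a - 2 * s)) (Ioi 1) :=
      integrableOn_Ioi_rpow_of_lt (by linarith) one_pos
    refine (setLIntegral_mono' measurableSet_Ioi fun r hr => ?_).trans_lt hi.lintegral_lt_top
    have hr0 : (0 : ℝ) < r := one_pos.trans hr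
    refine hle r _ hr0 ?_
    rw [rpow_mul hr0.le, rpow_two]
    gcongr
    linarith

/-- The Fourier extension of the restriction of `h` to the sphere of radius `r`. -/
def sphereExt {n : ℕ} (h : E n → ℂ) (r : ℝ) (x : E n) : ℂ :=
  ∫ ω : sphere (0 : E n) 1, unitExp ⟪x, r • (ω : E n)⟫ * h (r • (ω : E n))
    ∂(volume : Measure (E n)).toSphere

lemma measurable_sphereExt {n : ℕ} {h : E n → ℂ} (hh : Measurable h) :
    Measurable fun p : E n × Ioi (0 : ℝ) => sphereExt h p.2 p.1 :=
  measurable_integral_right (F := fun q : (E n × Ioi (0 : ℝ)) × sphere (0 : E n) 1 =>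
    unitExp ⟪q.1.1, (q.1.2 : ℝ) • (q.2 : E n)⟫ * h ((q.1.2 : ℝ) • (q.2 : E n))) (by fun_prop)

lemma norm_smul_sphere {n : ℕ} (ω : sphere (0 : E n) 1) (r : Ioi (0 : ℝ)) :
    ‖(r : ℝ) • (ω : E n)‖ = r := by
  rw [norm_smul, norm_eq_of_mem_sphere ω, mul_one, norm_of_nonneg (le_of_lt r.2)]

lemma enorm_halfWave_le {n : ℕ} [Nontrivial (E n)] {f : E n → ℂ} (hf : Integrable (FT f)) (t : ℝ)
    (x : E n) : ‖halfWave f t x‖ₑ ≤ ∫⁻ r, ‖sphereExt (FT f) (r : Ioi (0 : ℝ)) x‖ₑ ∂radialMeasure n := by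
  set F : E n → ℂ := fun ξ => unitExp (⟪x, ξ⟫ + t * ‖ξ‖) * FT f ξ
  have hF : Integrable F := by
    refine hf.bdd_mul (c := 1) ?_ (Filter.Eventually.of_forall fun ξ => (norm_unitExp _).le)
    exact Measurable.aestronglyMeasurable (by fun_prop)
  change ‖∫ ξ, F ξ‖ₑ ≤ _
  rw [integral_polar, integral_prod_symm _ (integrable_polar hF)]
  refine (enorm_integral_le_lintegral_enorm _).trans (lintegral_mono fun r => le_of_eq ?_)
  simp only [F, norm_smul_sphere]
  have : ∀ ω : sphere (0 : E n) 1, unitExp (⟪x, (r : ℝ) • (ω : E n)⟫ + t * r) *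
      FT f ((r : ℝ) • (ω : E n)) = unitExp (t * r) *
      (unitExp ⟪x, (r : ℝ) • (ω : E n)⟫ * FT f ((r : ℝ) • (ω : E n))) := fun ω => by
    rw [unitExp_add]; ring
  simp_rw [this]
  rw [integral_const_mul, enorm_mul, ← ofReal_norm (unitExp _), norm_unitExp, ENNReal.ofReal_one,
    one_mul, sphereExt]

lemma radialWeight_mul_lintegral_sphereExt_le {n : ℕ} {s a α C : ℝ} (hC0 : 0 < C)
    (μ : Measure (E n)) [IsFiniteMeasure μ] (hμ : μ (ball (0 : E n) 1)ᶜ = 0)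
    (hM : frostman μ α < ⊤) (r : Ioi (0 : ℝ))
    (hC : ∀ᵐ x ∂μ, ∫ x', ‖sphereFT ((r : ℝ) • (x' - x))‖ ∂μ ≤
      C * (frostman μ α).toReal * (r : ℝ) ^ (-a))
    {h : E n → ℂ} (hh : Measurable h) {B : ℝ} (hB : ∀ ξ, ‖h ξ‖ ≤ B) :
    ∫⁻ x, ENNReal.ofReal (radialWeight s a r) * ‖sphereExt h r x‖ₑ ^ 2 ∂μ ≤
      ENNReal.ofReal (C * (frostman μ α).toReal) * ∫⁻ ω : sphere (0 : E n) 1,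
        ENNReal.ofReal ((1 + ‖(r : ℝ) • (ω : E n)‖ ^ 2) ^ s) * ‖h ((r : ℝ) • (ω : E n))‖ₑ ^ 2
          ∂(volume : Measure (E n)).toSphere := by
  have hr : (0 : ℝ) < r := r.2
  have hx : Measurable fun x => ‖sphereExt h r x‖ₑ ^ 2 :=
    ((measurable_sphereExt hh).comp measurable_prodMk_right).enorm.pow_const 2
  simp only [norm_smul_sphere]
  rw [lintegral_const_mul _ hx, lintegral_const_mul _ (by fun_prop)]
  calc _ ≤ ENNReal.ofReal (radialWeight s a r) *
        (ENNReal.ofReal (C * (frostman μ α).toReal * (r : ℝ) ^ (-a)) *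
        ∫⁻ ω : sphere (0 : E n) 1, ‖h ((r : ℝ) • (ω : E n))‖ₑ ^ 2
          ∂(volume : Measure (E n)).toSphere) := by
        gcongr
        exact lintegral_sphere_extension_le hC0 μ hμ hM hr hC
          (g := fun ω => h ((r : ℝ) • (ω : E n))) (by fun_prop) fun ω => hB _
    _ = _ := by
        rw [← mul_assoc, ← mul_assoc, ← ENNReal.ofReal_mul (radialWeight_pos s a hr).le,
          ← ENNReal.ofReal_mul (by positivity)]
        congr 2
        rw [radialWeight, rpow_neg hr.le]
        have := (rpow_pos_of_pos hr a).ne'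
        field_simp

lemma lintegral_radialWeight_sphereExt_le {n : ℕ} [Nontrivial (E n)] {s a α C : ℝ} (hC0 : 0 < C)
    (μ : Measure (E n)) [IsFiniteMeasure μ] (hμ : μ (ball (0 : E n) 1)ᶜ = 0)
    (hM : frostman μ α < ⊤)
    (hC : ∀ r : ℝ, 0 < r →
      ∀ᵐ x ∂μ, ∫ x', ‖sphereFT (r • (x' - x))‖ ∂μ ≤ C * (frostman μ α).toReal * r ^ (-a))
    {h : E n → ℂ} (hh : Measurable h) {B : ℝ} (hB : ∀ ξ, ‖h ξ‖ ≤ B) :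
    ∫⁻ r : Ioi (0 : ℝ), ∫⁻ x, ENNReal.ofReal (radialWeight s a r) * ‖sphereExt h r x‖ₑ ^ 2 ∂μ
        ∂(radialMeasure n) ≤
      ENNReal.ofReal (C * (frostman μ α).toReal) *
        ∫⁻ ξ, ENNReal.ofReal ((1 + ‖ξ‖ ^ 2) ^ s) * ‖h ξ‖ₑ ^ 2 := by
  rw [lintegral_polar _ (by fun_prop), lintegral_prod_symm _ (by fun_prop),
    ← lintegral_const_mul' _ _ ENNReal.ofReal_ne_top]
  exact lintegral_mono fun r =>
    radialWeight_mul_lintegral_sphereExt_le hC0 μ hμ hM r (hC r r.2) hh hB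

theorem lintegral_sq_lintegral_sphereExt_le {n : ℕ} [Nontrivial (E n)] {s a α C : ℝ} (hC0 : 0 < C)
    (μ : Measure (E n)) [IsFiniteMeasure μ] (hμ : μ (ball (0 : E n) 1)ᶜ = 0)
    (hM : frostman μ α < ⊤)
    (hC : ∀ r : ℝ, 0 < r →
      ∀ᵐ x ∂μ, ∫ x', ‖sphereFT (r • (x' - x))‖ ∂μ ≤ C * (frostman μ α).toReal * r ^ (-a))
    {h : E n → ℂ} (hh : Measurable h) {B : ℝ} (hB : ∀ ξ, ‖h ξ‖ ≤ B) :
    ∫⁻ x, (∫⁻ r, ‖sphereExt h (r : Ioi (0 : ℝ)) x‖ₑ ∂radialMeasure n) ^ 2 ∂μ ≤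
      (∫⁻ r : Ioi (0 : ℝ), (ENNReal.ofReal (radialWeight s a r))⁻¹ ∂(radialMeasure n)) *
        (ENNReal.ofReal (C * (frostman μ α).toReal) *
          ∫⁻ ξ, ENNReal.ofReal ((1 + ‖ξ‖ ^ 2) ^ s) * ‖h ξ‖ₑ ^ 2) := by
  have hG := measurable_sphereExt hh
  have hGx : ∀ x, Measurable fun r : Ioi (0 : ℝ) => ‖sphereExt h r x‖ₑ := fun x =>
    hG.enorm.of_uncurry_left (f := fun (x : E n) (r : Ioi (0 : ℝ)) => ‖sphereExt h r x‖ₑ)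
  have hWG : Measurable fun p : E n × Ioi (0 : ℝ) =>
      ENNReal.ofReal (radialWeight s a p.2) * ‖sphereExt h p.2 p.1‖ₑ ^ 2 := by fun_prop
  have hx : ∀ x, (∫⁻ r, ‖sphereExt h (r : Ioi (0 : ℝ)) x‖ₑ ∂radialMeasure n) ^ 2 ≤
      (∫⁻ r : Ioi (0 : ℝ), (ENNReal.ofReal (radialWeight s a r))⁻¹ ∂(radialMeasure n)) *
        ∫⁻ r : Ioi (0 : ℝ), ENNReal.ofReal (radialWeight s a r) * ‖sphereExt h r x‖ₑ ^ 2
          ∂(radialMeasure n) := fun x => by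
    refine sq_lintegral_le (by fun_prop) (hGx x) (fun r => ?_)
      fun r => ENNReal.ofReal_ne_top
    simpa using radialWeight_pos s a r.2
  refine (lintegral_mono hx).trans ?_
  rw [lintegral_const_mul _ hWG.lintegral_prod_right', lintegral_lintegral_swap hWG.aemeasurable]
  exact mul_le_mul_right (lintegral_radialWeight_sphereExt_le hC0 μ hμ hM hC hh hB) _

lemma FT_eq_fourier {n : ℕ} (f : SchwartzMap (E n) ℂ) :
    FT ⇑f = ⇑(FourierTransform.fourier f : SchwartzMap (E n) ℂ) := by
  ext ξ
  rw [SchwartzMap.fourier_coe, Real.fourier_eq']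
  rfl

lemma integrable_sobolev {n : ℕ} (h : SchwartzMap (E n) ℂ) (s : ℝ) :
    Integrable fun ξ : E n => (1 + ‖ξ‖ ^ 2) ^ s * ‖h ξ‖ ^ 2 := by
  obtain ⟨k, hk⟩ := exists_nat_ge s
  obtain ⟨B, hB⟩ := h.decay 0 0
  simp only [pow_zero, one_mul, norm_iteratedFDeriv_zero] at hB
  have hB0 : 0 ≤ B := (norm_nonneg _).trans (hB.2 0)
  have hi : Integrable fun ξ : E n => (2 ^ k * B) * (‖ξ‖ ^ 0 * ‖h ξ‖ + ‖ξ‖ ^ (2 * k) * ‖h ξ‖) :=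
    ((h.integrable_pow_mul volume 0).add (h.integrable_pow_mul volume (2 * k))).const_mul _
  refine hi.mono' (Measurable.aestronglyMeasurable ?_) (Filter.Eventually.of_forall fun ξ => ?_)
  · have := h.continuous.measurable
    fun_prop
  have h1 : (1 + ‖ξ‖ ^ 2) ^ s ≤ 2 ^ k * (1 + ‖ξ‖ ^ (2 * k)) := by
    calc (1 + ‖ξ‖ ^ 2) ^ s ≤ (1 + ‖ξ‖ ^ 2) ^ (k : ℝ) :=
          rpow_le_rpow_of_exponent_le (by nlinarith [sq_nonneg ‖ξ‖]) hk
      _ = (1 + ‖ξ‖ ^ 2) ^ k := rpow_natCast _ _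
      _ ≤ 2 ^ (k - 1) * (1 ^ k + (‖ξ‖ ^ 2) ^ k) := add_pow_le zero_le_one (by positivity) k
      _ ≤ 2 ^ k * (1 + ‖ξ‖ ^ (2 * k)) := by
          rw [one_pow, pow_mul]; gcongr <;> simp
  rw [norm_of_nonneg (by positivity)]
  calc (1 + ‖ξ‖ ^ 2) ^ s * ‖h ξ‖ ^ 2 ≤ (2 ^ k * (1 + ‖ξ‖ ^ (2 * k))) * (‖h ξ‖ * B) := by
        refine mul_le_mul h1 ?_ (by positivity) (by positivity)
        rw [sq]
        exact mul_le_mul_of_nonneg_left (hB.2 ξ) (norm_nonneg _)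
    _ = _ := by ring

end Assembly

section Maximal

lemma ofReal_iSup_sq_norm_le {ι : Type*} [Nonempty ι] {u : ι → ℂ} {T : ℝ≥0∞}
    (h : ∀ t, ‖u t‖ₑ ≤ T) : ENNReal.ofReal (⨆ t, ‖u t‖ ^ 2) ≤ T ^ 2 := by
  by_cases hT : T = ⊤
  · simp [hT]
  rw [← ENNReal.ofReal_toReal hT, ← ENNReal.ofReal_pow ENNReal.toReal_nonneg]
  refine ENNReal.ofReal_le_ofReal (ciSup_le fun t => ?_)
  gcongr
  rw [← toReal_enorm]
  exact ENNReal.toReal_mono hT (h t)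

lemma lintegral_iSup_halfWave_le {n : ℕ} [Nontrivial (E n)] {s a α C : ℝ} (hC0 : 0 < C)
    (μ : Measure (E n)) [IsFiniteMeasure μ] (hμ : μ (ball (0 : E n) 1)ᶜ = 0)
    (hM : frostman μ α < ⊤)
    (hC : ∀ r : ℝ, 0 < r →
      ∀ᵐ x ∂μ, ∫ x', ‖sphereFT (r • (x' - x))‖ ∂μ ≤ C * (frostman μ α).toReal * r ^ (-a))
    (f : SchwartzMap (E n) ℂ) :
    ∫⁻ x, ENNReal.ofReal (⨆ t : Ioo (0 : ℝ) 1, ‖halfWave f t x‖ ^ 2) ∂μ ≤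
      (∫⁻ r : Ioi (0 : ℝ), (ENNReal.ofReal (radialWeight s a r))⁻¹ ∂(radialMeasure n)) *
        (ENNReal.ofReal (C * (frostman μ α).toReal) * ENNReal.ofReal (sobolevNorm f s ^ 2)) := by
  set h : SchwartzMap (E n) ℂ := FourierTransform.fourier f
  have hFT : FT ⇑f = ⇑h := FT_eq_fourier f
  obtain ⟨B, hB⟩ := h.decay 0 0
  simp only [pow_zero, one_mul, norm_iteratedFDeriv_zero] at hB
  have : Nonempty (Ioo (0 : ℝ) 1) := ⟨⟨1 / 2, by norm_num, by norm_num⟩⟩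
  have hS : ENNReal.ofReal (sobolevNorm f s ^ 2) =
      ∫⁻ ξ, ENNReal.ofReal ((1 + ‖ξ‖ ^ 2) ^ s) * ‖FT f ξ‖ₑ ^ 2 := by
    have hnn : 0 ≤ ∫ ξ : E n, (1 + ‖ξ‖ ^ 2) ^ s * ‖FT f ξ‖ ^ 2 :=
      integral_nonneg fun ξ => by positivity
    rw [sobolevNorm, ← rpow_natCast, ← rpow_mul hnn, show (1 / 2 : ℝ) * (2 : ℕ) = 1 by norm_num,
      rpow_one, hFT, ofReal_integral_eq_lintegral_ofReal (integrable_sobolev h s)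
        (Filter.Eventually.of_forall fun ξ => by positivity)]
    refine lintegral_congr fun ξ => ?_
    rw [ENNReal.ofReal_mul (by positivity), ENNReal.ofReal_pow (norm_nonneg _), ofReal_norm]
  rw [hS]
  have hT := lintegral_sq_lintegral_sphereExt_le (s := s) hC0 μ hμ hM hC
    (h := FT f) (by rw [hFT]; exact h.continuous.measurable) (B := B) (by rw [hFT]; exact hB.2)
  exact (lintegral_mono fun x => ofReal_iSup_sq_norm_le fun t : Ioo (0 : ℝ) 1 =>
    enorm_halfWave_le (by rw [hFT]; exact h.integrable) (t : ℝ) x).trans hT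

end Maximal

/-- the `L²` maximal estimate for the half-wave propagator with respect to
fractal measures holds with `s > (n-α)/2` in the range `0 < α ≤ (n-1)/2`. -/
theorem maximal_L2_low_dimension (n : ℕ) (hn : 2 ≤ n) (α s : ℝ)
    (hα₀ : 0 < α) (hα₁ : α ≤ ((n : ℝ) - 1) / 2) (hs : ((n : ℝ) - α) / 2 < s) :
    ∃ C : ℝ, 0 < C ∧
      ∀ (μ : Measure (E n)), IsFiniteMeasure μ →
        μ (Metric.ball (0 : E n) 1)ᶜ = 0 → frostman μ α < ⊤ →
        ∀ (f : SchwartzMap (E n) ℂ),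
          (∫ x, (⨆ t : Set.Ioo (0:ℝ) 1, ‖halfWave (⇑f) t x‖ ^ 2) ∂μ) ≤
            C * (frostman μ α).toReal * sobolevNorm (⇑f) s ^ 2 := by
  have : Nonempty (Fin n) := ⟨⟨0, by omega⟩⟩
  have hn' : (2 : ℝ) ≤ n := by exact_mod_cast hn
  obtain ⟨a, ha, haα⟩ : ∃ a, max 0 ((n : ℝ) - 2 * s) < a ∧ a < α :=
    exists_between (max_lt hα₀ (by linarith))
  obtain ⟨ha0, has⟩ := max_lt_iff.1 ha
  obtain ⟨C, hC0, hC⟩ := integral_sphereFT_le hn ha0.le haα hα₁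
  have hI := lintegral_inv_radialWeight_lt_top hn (s := s) (a := a) (by linarith) (by linarith) has
  set I := ∫⁻ r : Ioi (0 : ℝ), (ENNReal.ofReal (radialWeight s a r))⁻¹ ∂(radialMeasure n) with hIdef
  refine ⟨(I.toReal + 1) * C, by positivity, fun μ hfin hμ hM f => ?_⟩
  have key := lintegral_iSup_halfWave_le (s := s) hC0 μ hμ hM (hC μ hμ hM) f
  rw [← ENNReal.ofReal_mul (by positivity), ← hIdef, ← ENNReal.ofReal_toReal hI.ne,
    ← ENNReal.ofReal_mul (by positivity)] at key
  calc _ ≤ ‖∫ x, (⨆ t : Set.Ioo (0:ℝ) 1, ‖halfWave (⇑f) t x‖ ^ 2) ∂μ‖ := le_norm_self _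
    _ ≤ I.toReal * (C * (frostman μ α).toReal * sobolevNorm f s ^ 2) := by
        refine (norm_integral_le_lintegral_norm _).trans
          (ENNReal.toReal_le_of_le_ofReal (by positivity) (le_trans (le_of_eq ?_) key))
        refine lintegral_congr fun x => ?_
        rw [norm_of_nonneg (Real.iSup_nonneg fun t => by positivity)]
    _ ≤ (I.toReal + 1) * (C * (frostman μ α).toReal * sobolevNorm f s ^ 2) := by
        gcongr; linarith
    _ = _ := by ring
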